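/- Let g : [0,∞) → ℝ be continuous with nonuniformly bounded growth with constants ã ≥ 0, b̃ ≥ 0, d̃ ≥ 0. Let H > 0 and M > 0 and suppose ∫_t^{t+H} g(τ) dτ ≥ MH for all t ≥ 0. Then for all t ≥ s ≥ 0, ∫_s^t g(τ) dτ ≥ (M − b̃)(t−s) − b̃s − (ãH + d̃). -/

import Mathlib

/-- A lower bound on every window of length `H` starting in `[0, ∞)` adds up over consecutive
windows. -/
theorem nat_mul_le_integral_of_window_le {g : ℝ → ℝ} (hg : Continuous g) {H C : ℝ} (hH : 0 ≤ H)
    (hwindow : ∀ t : ℝ, 0 ≤ t → C ≤ ∫ τ in t..(t + H), g τ) {s : ℝ} (hs : 0 ≤ s) (n : ℕ) :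
    n * C ≤ ∫ τ in s..(s + n * H), g τ := by
  induction n with
  | zero => simp
  | succ k ih =>
    have hk := hwindow (s + k * H) (by positivity)
    have hadd := intervalIntegral.integral_add_adjacent_intervals (μ := MeasureTheory.volume)
      (hg.intervalIntegrable s (s + k * H))
      (hg.intervalIntegrable (s + k * H) (s + k * H + H))
    have hend : s + ((k + 1 : ℕ) : ℝ) * H = s + k * H + H := by push_cast; ring
    rw [hend, ← hadd]
    push_cast
    linarith

/-- Let `g` be continuous with nonuniformly bounded growth with constants
`ã ≥ 0`, `b̃ ≥ 0`, `d̃ ≥ 0`. Let `H > 0` and `M > 0` and suppose `∫_t^{t+H} g ≥ M H` for all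
`t ≥ 0`. Then for all `t ≥ s ≥ 0`, `∫_s^t g ≥ (M - b̃)(t-s) - b̃ s - (ã H + d̃)`. -/
theorem window_lower_bound_implies_integral_lower_bound
    (g : ℝ → ℝ) (hg : Continuous g)
    (ta tb td : ℝ) (hta : 0 ≤ ta) (htb : 0 ≤ tb) (htd : 0 ≤ td)
    (hgrowth : ∀ s t : ℝ, 0 ≤ s → s ≤ t →
      (∫ τ in s..t, |g τ|) ≤ ta * (t - s) + tb * s + td)
    (H : ℝ) (hH : 0 < H) (M : ℝ) (hM : 0 < M)
    (hwindow : ∀ t : ℝ, 0 ≤ t → M * H ≤ ∫ τ in t..(t + H), g τ) :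
    ∀ s t : ℝ, 0 ≤ s → s ≤ t →
      (M - tb) * (t - s) - tb * s - (ta * H + td) ≤ ∫ τ in s..t, g τ := by
  intro s t hs hst
  set n := ⌊(t - s) / H⌋₊
  set u := s + ((n + 1 : ℕ) : ℝ) * H with hu
  have hlow : n * H ≤ t - s :=
    (le_div_iff₀ hH).1 (Nat.floor_le (div_nonneg (sub_nonneg.2 hst) hH.le))
  have hupp : t - s < (n + 1) * H := (div_lt_iff₀ hH).1 (Nat.lt_floor_add_one _)
  push_cast at hu
  have htu : t ≤ u := by linarith
  have hwin := nat_mul_le_integral_of_window_le hg hH.le hwindow hs (n + 1)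
  have hadd := intervalIntegral.integral_add_adjacent_intervals (μ := MeasureTheory.volume)
    (hg.intervalIntegrable s t) (hg.intervalIntegrable t u)
  have htail : ∫ τ in t..u, g τ ≤ ∫ τ in t..u, |g τ| :=
    intervalIntegral.integral_mono_on htu (hg.intervalIntegrable t u)
      (hg.abs.intervalIntegrable t u) fun x _ => le_abs_self (g x)
  have hgr := hgrowth t u (hs.trans hst) htu
  have hM' : M * (t - s) ≤ M * ((n + 1) * H) := mul_le_mul_of_nonneg_left hupp.le hM.le
  have hta' : ta * (u - t) ≤ ta * H := mul_le_mul_of_nonneg_left (by linarith) hta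
  push_cast at hwin
  rw [← hu] at hwin
  linarith
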